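/- Let G be a gyrogroup. The commutator subgyrogroup G′ is a subgroup of G, i.e., (G′, ⊕) is a group (in particular, ⊕ is associative on G′). -/

import Mathlib

universe u v

/-- A gyrogroup: a groupoid `(G, +)` with a left identity `0`, left inverses `-a`,
gyroautomorphisms `gyr a b` (automorphisms of `(G, +)`) satisfying the left
gyroassociative law, and the left loop property. -/
class Gyrogroup (G : Type u) extends Add G, Zero G, Neg G where
  /-- (G1) left identity -/
  zero_add' : ∀ a : G, 0 + a = a
  /-- (G2) left inverse -/
  neg_add' : ∀ a : G, -a + a = 0
  /-- (G3) the gyroautomorphisms, as bijections of `G` -/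
  gyr : G → G → G ≃ G
  /-- (G3) each `gyr a b` preserves the operation, i.e. is an automorphism -/
  gyr_add' : ∀ a b x y : G, gyr a b (x + y) = gyr a b x + gyr a b y
  /-- (G3) left gyroassociative law -/
  add_gyr_assoc' : ∀ a b c : G, a + (b + c) = (a + b) + gyr a b c
  /-- (G4) left loop property -/
  left_loop' : ∀ a b : G, gyr (a + b) b = gyr a b

open Gyrogroup

variable {G : Type u}

/-- A subgyrogroup: a nonempty subset closed under the operation and inverses. -/
structure IsSubgyrogroup [Gyrogroup G] (H : Set G) : Prop where
  nonempty : H.Nonempty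
  add_mem : ∀ ⦃a : G⦄, a ∈ H → ∀ ⦃b : G⦄, b ∈ H → a + b ∈ H
  neg_mem : ∀ ⦃a : G⦄, a ∈ H → -a ∈ H

/-- A gyrogroup homomorphism: a map preserving the operation. -/
def IsGyroHom [Gyrogroup G] {A : Type v} [Gyrogroup A] (φ : G → A) : Prop :=
  ∀ x y : G, φ (x + y) = φ x + φ y

/-- The kernel of a map into a gyrogroup. -/
def gyroKer [Gyrogroup G] {A : Type v} [Gyrogroup A] (φ : G → A) : Set G :=
  {x : G | φ x = 0}

/-- A normal subgyrogroup: the kernel of some gyrogroup homomorphism from `G`. -/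
def IsNormalSubgyrogroup [Gyrogroup G] (N : Set G) : Prop :=
  IsSubgyrogroup N ∧ ∃ (A : Type u) (instA : Gyrogroup A) (φ : G → A),
    @IsGyroHom G _ A instA φ ∧ N = @gyroKer G _ A instA φ

/-- The gyrocommutator `[a, b] = -(a + b) + gyr a b (b + a)`. -/
def gyroCommutator [Gyrogroup G] (a b : G) : G :=
  -(a + b) + gyr a b (b + a)

/-- The set of all gyrocommutators of `G`. -/
def gyroCommutatorSet (G : Type u) [Gyrogroup G] : Set G :=
  {x : G | ∃ a b : G, x = gyroCommutator a b}

/-- `K` is the commutator subgyrogroup `G'` of `G`: the smallest subgyrogroup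
containing all commutators. -/
def IsCommutatorSubgyrogroup [Gyrogroup G] (K : Set G) : Prop :=
  IsSubgyrogroup K ∧ gyroCommutatorSet G ⊆ K ∧
    ∀ H : Set G, IsSubgyrogroup H → gyroCommutatorSet G ⊆ H → K ⊆ H

/-- `K` is the normal closure `⟨⟨A⟩⟩` of `A`: the smallest normal subgyrogroup
containing `A`. -/
def IsGyroNormalClosure [Gyrogroup G] (A K : Set G) : Prop :=
  IsNormalSubgyrogroup K ∧ A ⊆ K ∧
    ∀ N : Set G, IsNormalSubgyrogroup N → A ⊆ N → K ⊆ N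

/-- The left coset `a ⊕ H`. -/
def lcoset [Gyrogroup G] (a : G) (H : Set G) : Set G := (a + ·) '' H

/-- The right coset `H ⊕ a`. -/
def rcoset [Gyrogroup G] (H : Set G) (a : G) : Set G := (· + a) '' H

/-- A gyrogroup is gyrocommutative if `a + b = gyr a b (b + a)` for all `a, b`. -/
def IsGyrocommutative (G : Type u) [Gyrogroup G] : Prop :=
  ∀ a b : G, a + b = gyr a b (b + a)

/-- An L-subgyrogroup: a subgyrogroup with `gyr a h (H) = H` for all `a ∈ G`, `h ∈ H`. -/
def IsLSubgyrogroup [Gyrogroup G] (H : Set G) : Prop :=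
  IsSubgyrogroup H ∧ ∀ a : G, ∀ h ∈ H, ⇑(gyr a h) '' H = H

/-- A subgroup of a gyrogroup: a subgyrogroup that forms a group under the gyrogroup
operation (equivalently, on which the operation is associative; together with the
closure properties and the identity and inverses inherited from `G`, this makes it
a group). -/
def IsSubgroupOfGyrogroup [Gyrogroup G] (H : Set G) : Prop :=
  IsSubgyrogroup H ∧ ∀ a ∈ H, ∀ b ∈ H, ∀ c ∈ H, a + (b + c) = (a + b) + c

/-- The left nucleus of `G`. -/
def leftNucleus (G : Type u) [Gyrogroup G] : Set G :=
  {a : G | ∀ b c : G, a + (b + c) = (a + b) + c}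

/-- The middle nucleus of `G`. -/
def middleNucleus (G : Type u) [Gyrogroup G] : Set G :=
  {b : G | ∀ a c : G, a + (b + c) = (a + b) + c}

/-- The right nucleus of `G`. -/
def rightNucleus (G : Type u) [Gyrogroup G] : Set G :=
  {c : G | ∀ a b : G, a + (b + c) = (a + b) + c}

/-- `L(G)`: the set of left gyrotranslations of `G`, viewed as permutations of `G`.
A permutation `σ` is a left gyrotranslation when `σ x = a + x` for some fixed `a`. -/
def LSet (G : Type u) [Gyrogroup G] : Set (Equiv.Perm G) :=
  {σ : Equiv.Perm G | ∃ a : G, ∀ x : G, σ x = a + x}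

/-- `L(H)` for a subset `H ⊆ G`: the left gyrotranslations by elements of `H`. -/
def LSetOf [Gyrogroup G] (H : Set G) : Set (Equiv.Perm G) :=
  {σ : Equiv.Perm G | ∃ a ∈ H, ∀ x : G, σ x = a + x}

/-- The left multiplication group `LMlt(G)`: the subgroup of `Sym(G)` generated by
the left gyrotranslations. -/
def LMlt (G : Type u) [Gyrogroup G] : Subgroup (Equiv.Perm G) :=
  Subgroup.closure (LSet G)

/-- `L(G)'`: the set of products `L_{a₁} ∘ ⋯ ∘ L_{aₙ}` of left gyrotranslations whose
reversed product `L_{aₙ} ∘ ⋯ ∘ L_{a₁}` is the identity. -/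
def LPrime (G : Type u) [Gyrogroup G] : Set (Equiv.Perm G) :=
  {σ : Equiv.Perm G | ∃ l : List (Equiv.Perm G),
    (∀ τ ∈ l, τ ∈ LSet G) ∧ σ = l.prod ∧ l.reverse.prod = 1}

/-- `L(G)^# = ⋂_{a ∈ G} L_a ∘ L(G)`. -/
def LSharp (G : Type u) [Gyrogroup G] : Set (Equiv.Perm G) :=
  {σ : Equiv.Perm G | ∀ ρ ∈ LSet G, ∃ τ ∈ LSet G, σ = ρ * τ}

/-- The radical of `G`: elements whose left gyrotranslation lies in `L(G)'`. -/
def gyroRadical (G : Type u) [Gyrogroup G] : Set G :=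
  {a : G | ∃ σ ∈ LPrime G, ∀ x : G, σ x = a + x}

/-- `X` is a normal subgroup of the subgroup `Γ` (as a subset of the ambient group). -/
def IsNormalSubgroupIn {M : Type v} [Group M] (Γ : Subgroup M) (X : Set M) : Prop :=
  X ⊆ (Γ : Set M) ∧ (1 : M) ∈ X ∧ (∀ σ ∈ X, σ⁻¹ ∈ X) ∧
    (∀ σ ∈ X, ∀ τ ∈ X, σ * τ ∈ X) ∧ ∀ γ ∈ Γ, ∀ σ ∈ X, γ * σ * γ⁻¹ ∈ X

/-- The coaddition `a ⊞ b = a + gyr a (-b) b`. -/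
def gyroCoadd [Gyrogroup G] (a b : G) : G := a + gyr a (-b) b

/-- Natural-number multiples: `0 • a = 0`, `(m+1) • a = a + m • a`. -/
def gyroNsmul [Gyrogroup G] : ℕ → G → G
  | 0, _ => 0
  | n + 1, a => a + gyroNsmul n a

/-- The index `[G : H]`: the number of left cosets of `H` in `G`. -/
noncomputable def gyroIndex [Gyrogroup G] (H : Set G) : ℕ :=
  Set.ncard {S : Set G | ∃ a : G, S = lcoset a H}

namespace Gyrogroup

variable [Gyrogroup G]

theorem add_left_injective_of_gyro {a b c : G} (h : a + b = a + c) : b = c := by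
  have h' : -a + (a + b) = -a + (a + c) := by rw [h]
  rw [add_gyr_assoc', add_gyr_assoc', neg_add', zero_add', zero_add'] at h'
  exact (gyr (-a) a).injective h'

theorem gyr_zero_left (a c : G) : gyr 0 a c = c := by
  have h := add_gyr_assoc' 0 a c
  rw [zero_add', zero_add'] at h
  exact (add_left_injective_of_gyro h).symm

theorem neg_add_add (a b : G) : -a + (a + b) = b := by
  have h := left_loop' (-a) a
  rw [neg_add'] at h
  rw [add_gyr_assoc', neg_add', zero_add', ← h, gyr_zero_left]

theorem add_zero_right (a : G) : a + 0 = a := by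
  apply add_left_injective_of_gyro (a := -a)
  rw [neg_add_add, neg_add']

theorem add_neg_add (a b : G) : a + (-a + b) = b := by
  apply add_left_injective_of_gyro (a := -a)
  rw [neg_add_add]

/-- The left Bol identity. -/
theorem add_add_add_bol (p q t : G) :
    p + (q + (p + t)) = (p + (q + p)) + t := by
  obtain ⟨s, hs⟩ : ∃ s, (q + p) + s = q + (p + t) :=
    ⟨-(q + p) + (q + (p + t)), add_neg_add _ _⟩
  have hgyr : gyr p (q + p) = gyr (-q) (q + p) := by
    have h := left_loop' (-q) (q + p)
    rwa [neg_add_add] at h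
  have ht : gyr (-q) (q + p) s = t := by
    have h := add_gyr_assoc' (-q) (q + p) s
    rw [hs, neg_add_add, neg_add_add] at h
    exact (add_left_injective_of_gyro h).symm
  rw [← hs, add_gyr_assoc', hgyr, ht]

/-- Every gyrocommutator lies in the left nucleus. -/
theorem gyroCommutator_mem_leftNucleus (a b : G) : gyroCommutator a b ∈ leftNucleus G := by
  set F : G → G := fun t => -(a + b) + gyr a b (b + (a + t)) with hF
  have key : ∀ y : G, ∃ w : G, ∀ t : G, F (y + t) = w + t := by
    intro y
    obtain ⟨u, hu⟩ : ∃ u : G, ∀ t, a + (y + (a + t)) = u + t := ⟨_, add_add_add_bol a y⟩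
    obtain ⟨v, hv⟩ : ∃ v : G, ∀ t, b + (u + (b + t)) = v + t := ⟨_, add_add_add_bol b u⟩
    obtain ⟨w, hw⟩ : ∃ w : G, ∀ t, -(a + b) + (gyr a b v + (-(a + b) + t)) = w + t :=
      ⟨_, add_add_add_bol _ _⟩
    refine ⟨w, fun t => ?_⟩
    have ht : a + (b + (-b + (-a + t))) = t := by rw [add_neg_add, add_neg_add]
    have hg : -(a + b) + t = gyr a b (-b + (-a + t)) := by
      rw [← neg_add_add (a + b) (gyr a b (-b + (-a + t))), ← add_gyr_assoc', ht]
    rw [← hw, hg, ← gyr_add', ← hv, ← hu, ht]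
  have hd : ∀ t : G, F t = gyroCommutator a b + t := by
    obtain ⟨w, hw⟩ := key 0
    have h0 : w = gyroCommutator a b := by
      rw [← add_zero_right w, ← hw, add_zero_right, hF]
      simp only [add_zero_right, gyroCommutator]
    intro t
    rw [← h0, ← hw, zero_add']
  intro y t
  obtain ⟨w, hw⟩ := key y
  have hwy : gyroCommutator a b + y = w := by
    rw [← hd, ← add_zero_right y, hw, add_zero_right]
  rw [hwy, ← hd, hw]

theorem isSubgyrogroup_leftNucleus : IsSubgyrogroup (leftNucleus G) where
  nonempty := ⟨0, fun b c => by rw [zero_add', zero_add']⟩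
  add_mem := by
    intro a ha a' ha' b c
    rw [← ha, ha', ha, ← ha a' b]
  neg_mem := by
    intro a ha b c
    apply add_left_injective_of_gyro (a := a)
    rw [add_neg_add, ha, add_neg_add]

end Gyrogroup

/-- the commutator subgyrogroup is a subgroup of `G`
(a subgyrogroup on which the operation is associative, hence a group). -/
theorem commutator_subgyrogroup_is_subgroup [Gyrogroup G]
    (GP : Set G) (hGP : IsCommutatorSubgyrogroup GP) :
    IsSubgroupOfGyrogroup GP := by
  obtain ⟨hsub, -, hmin⟩ := hGP
  refine ⟨hsub, fun a ha b _ c _ => ?_⟩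
  refine hmin _ isSubgyrogroup_leftNucleus ?_ ha b c
  rintro _ ⟨x, y, rfl⟩
  exact gyroCommutator_mem_leftNucleus x y
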